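/- arXiv:1305.2639 — 2 statements merged into one kernel-verified Lean document; each statement's English description precedes it below -/
import Mathlib

section
/- For every smooth compactly supported φ on ℝ³ and Z > 0, the hydrogen ground-state bound ∫ |∇φ|² dx − Z ∫ |φ(x)|²/|x| dx ≥ −(Z²/4)∫ |φ|² dx holds. -/
open MeasureTheory

namespace Hyd

abbrev E3 := EuclideanSpace ℝ (Fin 3)

noncomputable def s (ε : ℝ) (x : E3) : ℝ := Real.sqrt (‖x‖ ^ 2 + ε)

noncomputable def e (i : Fin 3) : E3 := EuclideanSpace.single i 1

lemma s_pos {ε : ℝ} (hε : 0 < ε) (x : E3) : 0 < s ε x := Real.sqrt_pos.2 (by positivity)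

lemma s_sq {ε : ℝ} (hε : 0 < ε) (x : E3) : s ε x ^ 2 = ‖x‖ ^ 2 + ε :=
  Real.sq_sqrt (by positivity)

lemma s_contDiff {ε : ℝ} (hε : 0 < ε) : ContDiff ℝ 1 (s ε) :=
  ContDiff.sqrt ((contDiff_norm_sq ℝ).add contDiff_const) (fun x => by positivity)

lemma coord_contDiff (i : Fin 3) : ContDiff ℝ 1 (fun x : E3 => x i) :=
  (EuclideanSpace.proj (𝕜 := ℝ) i).contDiff

lemma w_contDiff {ε : ℝ} (hε : 0 < ε) (i : Fin 3) : ContDiff ℝ 1 (fun x : E3 => x i / s ε x) :=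
  (coord_contDiff i).div (s_contDiff hε) (fun x => (s_pos hε x).ne')

lemma fderiv_w {ε : ℝ} (hε : 0 < ε) (i : Fin 3) (x : E3) :
    fderiv ℝ (fun x : E3 => x i / s ε x) x (e i) = 1 / s ε x - (x i) ^ 2 / s ε x ^ 3 := by
  have hs := s_pos hε x
  have h1 : HasFDerivAt (fun x : E3 => ‖x‖ ^ 2 + ε) (2 • (innerSL ℝ x)) x :=
    (hasStrictFDerivAt_norm_sq x).hasFDerivAt.add_const ε
  have h2 : HasFDerivAt (s ε) ((1 / (2 * s ε x)) • (2 • (innerSL ℝ x))) x :=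
    h1.sqrt (by positivity)
  have h3 : HasFDerivAt (fun x : E3 => x i) (EuclideanSpace.proj (𝕜 := ℝ) i) x :=
    (EuclideanSpace.proj (𝕜 := ℝ) i).hasFDerivAt
  have h4 := h3.mul ((hasDerivAt_inv hs.ne').comp_hasFDerivAt x h2)
  have h5 : (fun x : E3 => x i / s ε x) = (fun x : E3 => x i) * (Inv.inv ∘ s ε) := by
    funext y; simp [div_eq_mul_inv]
  rw [h5, h4.fderiv]
  simp [e, EuclideanSpace.inner_single_right]
  field_simp
  ring

lemma norm_grad_sq (φ : E3 → ℝ) (x : E3) :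
    ‖gradient φ x‖ ^ 2 = ∑ i, (fderiv ℝ φ x (e i)) ^ 2 := by
  rw [EuclideanSpace.real_norm_sq_eq]
  refine Finset.sum_congr rfl fun i _ => ?_
  have : gradient φ x i = inner ℝ (gradient φ x) (e i) := by
    rw [e, EuclideanSpace.inner_single_right]
    simp
  rw [this, gradient, InnerProductSpace.toDual_symm_apply]

lemma key {Z ε : ℝ} (hZ : 0 < Z) (hε : 0 < ε) {φ : E3 → ℝ}
    (hφ : ContDiff ℝ 1 φ) (hφc : HasCompactSupport φ) :
    Z * ∫ x, (φ x) ^ 2 / s ε x ≤ (∫ x, ‖gradient φ x‖ ^ 2) + Z ^ 2 / 4 * ∫ x, (φ x) ^ 2 := by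
  have hφ' : ∀ i, Continuous (fun x => fderiv ℝ φ x (e i)) := fun i =>
    (hφ.continuous_fderiv (by norm_num)).clm_apply continuous_const
  have hφc' : ∀ i, HasCompactSupport (fun x => fderiv ℝ φ x (e i)) := fun i =>
    (hφc.fderiv_apply ℝ (e i))
  have hsc : Continuous (s ε) := (s_contDiff hε).continuous
  have hw' : ∀ i, Continuous (fun x => fderiv ℝ (fun x : E3 => x i / s ε x) x (e i)) := fun i =>
    ((w_contDiff hε i).continuous_fderiv (by norm_num)).clm_apply continuous_const
  have hwc : ∀ i, Continuous (fun x : E3 => x i / s ε x) := fun i => (w_contDiff hε i).continuous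
  have hu : ContDiff ℝ 1 (fun x => φ x ^ 2) := hφ.pow 2
  have huc : HasCompactSupport (fun x => φ x ^ 2) := by
    have := hφc.mul_right (f' := φ)
    have h : (fun x => φ x ^ 2) = φ * φ := by
      funext x; simp [sq]
    rw [h]
    exact this
  have hud : ∀ i x, fderiv ℝ (fun x => φ x ^ 2) x (e i) = 2 * φ x * fderiv ℝ φ x (e i) := by
    intro i x
    have := ((hφ.differentiable (by norm_num) x).hasFDerivAt.pow 2).fderiv
    rw [this]; simp
  have I1 : ∀ i, Integrable (fun x => φ x ^ 2 *
      fderiv ℝ (fun x : E3 => x i / s ε x) x (e i)) := fun i =>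
    (hu.continuous.mul (hw' i)).integrable_of_hasCompactSupport huc.mul_right
  have I2 : ∀ i, Integrable (fun x => fderiv ℝ (fun x => φ x ^ 2) x (e i) *
      (x i / s ε x)) := fun i =>
    (((hu.continuous_fderiv (by norm_num)).clm_apply continuous_const).mul
      (hwc i)).integrable_of_hasCompactSupport (huc.fderiv_apply ℝ (e i)).mul_right
  have I3 : ∀ i, Integrable (fun x => φ x ^ 2 * (x i / s ε x)) := fun i =>
    (hu.continuous.mul (hwc i)).integrable_of_hasCompactSupport huc.mul_right
  have ibp : ∀ i, ∫ x, φ x ^ 2 * fderiv ℝ (fun x : E3 => x i / s ε x) x (e i) =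
      - ∫ x, fderiv ℝ (fun x => φ x ^ 2) x (e i) * (x i / s ε x) := fun i =>
    integral_mul_fderiv_eq_neg_fderiv_mul_of_integrable (I2 i) (I1 i) (I3 i)
      (fun x _ => hu.differentiable (by norm_num) x)
      (fun x _ => (w_contDiff hε i).differentiable (by norm_num) x)
  have J0 : Integrable (fun x => φ x ^ 2) := hu.continuous.integrable_of_hasCompactSupport huc
  have J1 : Integrable (fun x => φ x ^ 2 / s ε x) := by
    simp_rw [div_eq_mul_inv]
    exact (hu.continuous.mul (hsc.inv₀ fun x => (s_pos hε x).ne')).integrable_of_hasCompactSupport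
      huc.mul_right
  have J2 : Integrable (fun x => ‖gradient φ x‖ ^ 2) := by
    simp_rw [norm_grad_sq]
    refine integrable_finsetSum _ fun i _ => ?_
    simp_rw [sq]
    exact ((hφ' i).mul (hφ' i)).integrable_of_hasCompactSupport (hφc' i).mul_right
  have nsq : ∀ x : E3, ‖x‖ ^ 2 = x 0 ^ 2 + x 1 ^ 2 + x 2 ^ 2 := fun x => by
    rw [EuclideanSpace.real_norm_sq_eq, Fin.sum_univ_three]
  have A : 2 * ∫ x, φ x ^ 2 / s ε x ≤
      ∑ i, ∫ x, φ x ^ 2 * fderiv ℝ (fun x : E3 => x i / s ε x) x (e i) := by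
    rw [← integral_finsetSum _ fun i _ => I1 i, ← integral_const_mul]
    refine integral_mono (J1.const_mul 2) (integrable_finsetSum _ fun i _ => I1 i) fun x => ?_
    have hs := s_pos hε x
    have hs2 := s_sq hε x
    simp only [fderiv_w hε, Fin.sum_univ_three]
    rw [nsq] at hs2
    have : φ x ^ 2 * (1 / s ε x - x 0 ^ 2 / s ε x ^ 3) + φ x ^ 2 * (1 / s ε x - x 1 ^ 2 / s ε x ^ 3)
      + φ x ^ 2 * (1 / s ε x - x 2 ^ 2 / s ε x ^ 3) - 2 * (φ x ^ 2 / s ε x)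
       = φ x ^ 2 * ε / s ε x ^ 3 := by
      have : ε = s ε x ^ 2 - (x 0 ^ 2 + x 1 ^ 2 + x 2 ^ 2) := by linarith
      generalize s ε x = t at *
      rw [this]
      field_simp
      ring
    have : 0 ≤ φ x ^ 2 * ε / s ε x ^ 3 := by positivity
    linarith
  have B : Z / 2 * (-∑ i, ∫ x, fderiv ℝ (fun x => φ x ^ 2) x (e i) * (x i / s ε x)) ≤
      (∫ x, ‖gradient φ x‖ ^ 2) + Z ^ 2 / 4 * ∫ x, (φ x) ^ 2 := by
    rw [← integral_finsetSum _ fun i _ => I2 i, ← integral_neg, ← integral_const_mul,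
      ← integral_const_mul, ← integral_add J2 (J0.const_mul _)]
    refine integral_mono ((integrable_finsetSum _ fun i _ => I2 i).neg.const_mul _)
      (J2.add (J0.const_mul _)) fun x => ?_
    have hs := s_pos hε x
    have hs2 := s_sq hε x
    rw [nsq] at hs2
    simp only [hud, norm_grad_sq, Fin.sum_univ_three]
    have hw : (x 0 / s ε x) ^ 2 + (x 1 / s ε x) ^ 2 + (x 2 / s ε x) ^ 2 ≤ 1 := by
      rw [div_pow, div_pow, div_pow, ← add_div, ← add_div, div_le_one (by positivity)]
      linarith
    have hw2 := mul_le_mul_of_nonneg_left hw (by positivity : 0 ≤ Z ^ 2 / 4 * φ x ^ 2)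
    nlinarith [sq_nonneg (fderiv ℝ φ x (e 0) + Z / 2 * φ x * (x 0 / s ε x)),
      sq_nonneg (fderiv ℝ φ x (e 1) + Z / 2 * φ x * (x 1 / s ε x)),
      sq_nonneg (fderiv ℝ φ x (e 2) + Z / 2 * φ x * (x 2 / s ε x))]
  simp_rw [ibp] at A
  rw [Finset.sum_neg_distrib] at A
  nlinarith [mul_le_mul_of_nonneg_left A (by positivity : 0 ≤ Z / 2)]

end Hyd

open Hyd in
theorem stmt_15 (Z : ℝ) (hZ : 0 < Z) (φ : EuclideanSpace ℝ (Fin 3) → ℝ)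
    (hφ : ContDiff ℝ (⊤ : ℕ∞) φ) (hφc : HasCompactSupport φ) :
    (∫ x, ‖gradient φ x‖ ^ 2) - Z * (∫ x, (φ x) ^ 2 / ‖x‖) ≥
      -(Z ^ 2 / 4) * ∫ x, (φ x) ^ 2 := by
  have hφ1 : ContDiff ℝ 1 φ := hφ.of_le (by exact_mod_cast le_top)
  by_cases hI : Integrable (fun x => (φ x) ^ 2 / ‖x‖)
  · have hlim : Filter.Tendsto (fun n : ℕ => ∫ x, φ x ^ 2 / s (1 / ((n : ℝ) + 1)) x) Filter.atTop
        (nhds (∫ x, φ x ^ 2 / ‖x‖)) := by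
      have hne : ∀ᵐ x : E3, x ≠ 0 := by
        simp [ae_iff]
      refine tendsto_integral_of_dominated_convergence (fun x => φ x ^ 2 / ‖x‖) ?_ hI ?_ ?_
      · intro n
        have hε : (0 : ℝ) < 1 / ((n : ℝ) + 1) := by positivity
        exact ((hφ1.continuous.pow 2).div (s_contDiff hε).continuous
          fun x => (s_pos hε x).ne').aestronglyMeasurable
      · intro n
        have hε : (0 : ℝ) < 1 / ((n : ℝ) + 1) := by positivity
        filter_upwards [hne] with x hx
        have h0 : 0 < ‖x‖ := norm_pos_iff.2 hx
        have hs := s_pos hε x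
        rw [Real.norm_of_nonneg (by positivity)]
        have : ‖x‖ ≤ s (1 / ((n : ℝ) + 1)) x := Real.le_sqrt_of_sq_le (by linarith)
        gcongr
      · filter_upwards [hne] with x hx
        have h0 : 0 < ‖x‖ := norm_pos_iff.2 hx
        refine Filter.Tendsto.div tendsto_const_nhds ?_ h0.ne'
        have h1 := (tendsto_one_div_add_atTop_nhds_zero_nat (𝕜 := ℝ)).const_add (‖x‖ ^ 2)
        have h2 := h1.sqrt
        simpa [s, Real.sqrt_sq h0.le] using h2
    have := le_of_tendsto' (hlim.const_mul Z)
      (fun n => key hZ (by positivity : (0 : ℝ) < 1 / ((n : ℝ) + 1)) hφ1 hφc)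
    linarith
  · rw [integral_undef hI]
    have h1 : 0 ≤ ∫ x, ‖gradient φ x‖ ^ 2 := integral_nonneg fun x => by positivity
    have h2 : 0 ≤ ∫ x, φ x ^ 2 := integral_nonneg fun x => by positivity
    have h3 : 0 ≤ Z ^ 2 / 4 * ∫ x, φ x ^ 2 := by positivity
    linarith
end

section
/- For every smooth function φ compactly supported in ℝⁿ with n ≥ 3, Hardy's inequality holds: ∫ |∇φ|² dx ≥ ((n−2)²/4) ∫ |φ(x)|²/|x|² dx. -/
open MeasureTheory

lemma hardy_g_deriv {n : ℕ} (ε : ℝ) (hε : 0 < ε) (i : Fin n) (x : EuclideanSpace ℝ (Fin n)) :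
    fderiv ℝ (fun x : EuclideanSpace ℝ (Fin n) => x i * (‖x‖ ^ 2 + ε)⁻¹) x
      (EuclideanSpace.single i 1) =
      (‖x‖ ^ 2 + ε)⁻¹ - 2 * (x i) ^ 2 * ((‖x‖ ^ 2 + ε)⁻¹) ^ 2 := by
  have hpos : ‖x‖ ^ 2 + ε ≠ 0 := by positivity
  have h1 : HasFDerivAt (fun x : EuclideanSpace ℝ (Fin n) => x i)
      (EuclideanSpace.proj i : EuclideanSpace ℝ (Fin n) →L[ℝ] ℝ) x :=
    (EuclideanSpace.proj i : EuclideanSpace ℝ (Fin n) →L[ℝ] ℝ).hasFDerivAt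
  have h2 := ((hasStrictFDerivAt_norm_sq x).hasFDerivAt.add_const ε)
  have h3 := (hasDerivAt_inv hpos).comp_hasFDerivAt x h2
  have h4 := h1.mul h3
  have h5 : fderiv ℝ (fun x : EuclideanSpace ℝ (Fin n) => x i * (‖x‖ ^ 2 + ε)⁻¹) x = _ :=
    h4.fderiv
  rw [h5]
  simp [EuclideanSpace.inner_single_right]
  field_simp
  ring

lemma hardy_g_contDiff {n : ℕ} (ε : ℝ) (hε : 0 < ε) (i : Fin n) :
    ContDiff ℝ 1 (fun x : EuclideanSpace ℝ (Fin n) => x i * (‖x‖ ^ 2 + ε)⁻¹) := by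
  have h1 : ContDiff ℝ 1 (fun x : EuclideanSpace ℝ (Fin n) => x i) :=
    (EuclideanSpace.proj i : EuclideanSpace ℝ (Fin n) →L[ℝ] ℝ).contDiff
  refine h1.mul (ContDiff.inv ((contDiff_norm_sq ℝ).add contDiff_const) ?_)
  intro x
  positivity

set_option maxHeartbeats 1000000 in
lemma hardy_eps {n : ℕ} (hn : 3 ≤ n) (φ : EuclideanSpace ℝ (Fin n) → ℝ)
    (hφ : ContDiff ℝ 1 φ) (hφc : HasCompactSupport φ) (ε : ℝ) (hε : 0 < ε) :
    (((n : ℝ) - 2) ^ 2 / 4) * ∫ x, (φ x) ^ 2 * (‖x‖ ^ 2 + ε)⁻¹ ≤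
      ∫ x, ‖gradient φ x‖ ^ 2 := by
  let e : Fin n → EuclideanSpace ℝ (Fin n) := fun i => EuclideanSpace.single i 1
  let g : Fin n → EuclideanSpace ℝ (Fin n) → ℝ := fun i x => x i * (‖x‖ ^ 2 + ε)⁻¹
  let f : EuclideanSpace ℝ (Fin n) → ℝ := fun x => φ x * φ x
  have hf : ContDiff ℝ 1 f := hφ.mul hφ
  have hfc : HasCompactSupport f := hφc.mul_right
  have hg : ∀ i, ContDiff ℝ 1 (g i) := fun i => hardy_g_contDiff ε hε i
  have cf' : ∀ v, Continuous (fun x => fderiv ℝ f x v) := fun v =>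
    (hf.continuous_fderiv one_ne_zero).clm_apply continuous_const
  have cg' : ∀ i v, Continuous (fun x => fderiv ℝ (g i) x v) := fun i v =>
    ((hg i).continuous_fderiv one_ne_zero).clm_apply continuous_const
  have i1 : ∀ i, Integrable (fun x => fderiv ℝ f x (e i) * g i x) := fun i =>
    ((cf' _).mul (hg i).continuous).integrable_of_hasCompactSupport
      ((hfc.fderiv_apply ℝ (e i)).mul_right)
  have i2 : ∀ i, Integrable (fun x => f x * fderiv ℝ (g i) x (e i)) := fun i =>
    (hf.continuous.mul (cg' i _)).integrable_of_hasCompactSupport hfc.mul_right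
  have i3 : ∀ i, Integrable (fun x => f x * g i x) := fun i =>
    (hf.continuous.mul (hg i).continuous).integrable_of_hasCompactSupport hfc.mul_right
  have ibp : ∀ i, ∫ x, (fderiv ℝ f x (e i) * g i x + f x * fderiv ℝ (g i) x (e i)) = 0 := by
    intro i
    rw [integral_add (i1 i) (i2 i), integral_mul_fderiv_eq_neg_fderiv_mul_of_integrable (i1 i)
      (i2 i) (i3 i) (fun x _ => hf.differentiable one_ne_zero x)
      (fun x _ => (hg i).differentiable one_ne_zero x)]
    ring
  have hgrad : ∀ x, ‖gradient φ x‖ ^ 2 = ∑ i, (fderiv ℝ φ x (e i)) ^ 2 := by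
    intro x
    rw [EuclideanSpace.norm_sq_eq]
    refine Finset.sum_congr rfl fun i _ => ?_
    rw [Real.norm_eq_abs, sq_abs]
    congr 1
    have : inner ℝ (gradient φ x) (e i) = fderiv ℝ φ x (e i) := by
      simp [gradient]
    rw [← this]
    rw [EuclideanSpace.inner_single_right]
    simp
  have cφ' : ∀ v, Continuous (fun x => fderiv ℝ φ x v) := fun v =>
    (hφ.continuous_fderiv one_ne_zero).clm_apply continuous_const
  have ig : Integrable (fun x => ‖gradient φ x‖ ^ 2) := by
    simp only [hgrad]
    refine integrable_finsetSum _ fun i _ => ?_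
    simp only [pow_two]
    exact ((cφ' _).mul (cφ' _)).integrable_of_hasCompactSupport
      ((hφc.fderiv_apply ℝ (e i)).mul_right)
  have iw : Integrable (fun x : EuclideanSpace ℝ (Fin n) => (φ x) ^ 2 * (‖x‖ ^ 2 + ε)⁻¹) := by
    simp only [pow_two (φ _)]
    refine Continuous.integrable_of_hasCompactSupport ?_ hfc.mul_right
    refine hf.continuous.mul (Continuous.inv₀ (by fun_prop) ?_)
    intro x
    positivity
  have iG : Integrable (fun x => ∑ i, (fderiv ℝ f x (e i) * g i x
      + f x * fderiv ℝ (g i) x (e i))) :=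
    integrable_finsetSum _ fun i _ => (i1 i).add (i2 i)
  have hG : ∫ x, ∑ i, (fderiv ℝ f x (e i) * g i x + f x * fderiv ℝ (g i) x (e i)) = 0 := by
    refine (integral_finsetSum _ fun i _ => (i1 i).add (i2 i)).trans ?_
    exact Finset.sum_eq_zero fun i _ => ibp i
  set c : ℝ := ((n : ℝ) - 2) / 2 with hc
  have hcpos : 0 ≤ c := by
    have : (3 : ℝ) ≤ n := by exact_mod_cast hn
    rw [hc]; linarith
  have hpt : ∀ x, (((n : ℝ) - 2) ^ 2 / 4) * ((φ x) ^ 2 * (‖x‖ ^ 2 + ε)⁻¹) ≤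
      ‖gradient φ x‖ ^ 2 + c * ∑ i, (fderiv ℝ f x (e i) * g i x
      + f x * fderiv ℝ (g i) x (e i)) := by
    intro x
    have hf' : ∀ v, fderiv ℝ f x v = 2 * φ x * fderiv ℝ φ x v := by
      intro v
      have hd := (hφ.differentiable one_ne_zero x).hasFDerivAt
      have : fderiv ℝ f x = _ := (hd.mul hd).fderiv
      rw [this]
      simp
      ring
    set w := (‖x‖ ^ 2 + ε)⁻¹ with hw
    have hwpos : 0 < w := by positivity
    have hw1 : ‖x‖ ^ 2 * w ≤ 1 := by
      rw [hw, ← div_eq_mul_inv, div_le_one (by positivity)]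
      linarith
    have hx : ‖x‖ ^ 2 = ∑ i, x i ^ 2 := by
      rw [EuclideanSpace.norm_sq_eq]; simp
    have hsq : 0 ≤ ∑ i, (fderiv ℝ φ x (e i) + c * φ x * (x i * w)) ^ 2 :=
      Finset.sum_nonneg fun i _ => sq_nonneg _
    have key : ‖gradient φ x‖ ^ 2 + c * ∑ i, (fderiv ℝ f x (e i) * g i x
        + f x * fderiv ℝ (g i) x (e i)) =
        ∑ i, (fderiv ℝ φ x (e i) + c * φ x * (x i * w)) ^ 2
        + c * φ x ^ 2 * w * n - (2 * c + c ^ 2) * φ x ^ 2 * w ^ 2 * ‖x‖ ^ 2 := by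
      have hn' : c * φ x ^ 2 * w * n = ∑ _i : Fin n, c * φ x ^ 2 * w := by
        simp; ring
      rw [hgrad, hn', hx, Finset.mul_sum, Finset.mul_sum, ← Finset.sum_add_distrib,
        ← Finset.sum_add_distrib, ← Finset.sum_sub_distrib]
      refine Finset.sum_congr rfl fun i _ => ?_
      have hg' : fderiv ℝ (g i) x (e i) = w - 2 * (x i) ^ 2 * w ^ 2 := hardy_g_deriv ε hε i x
      rw [hf', hg']
      simp only [f, g, ← hw]
      ring
    rw [key]
    have h6 : (2 * c + c ^ 2) * φ x ^ 2 * w * (‖x‖ ^ 2 * w) ≤ (2 * c + c ^ 2) * φ x ^ 2 * w * 1 :=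
      mul_le_mul_of_nonneg_left hw1 (by positivity)
    have hn2 : (n : ℝ) = 2 * c + 2 := by rw [hc]; ring
    rw [hn2]
    nlinarith
  rw [← integral_const_mul]
  calc _ ≤ ∫ x, (‖gradient φ x‖ ^ 2 + c * ∑ i, (fderiv ℝ f x (e i) * g i x
      + f x * fderiv ℝ (g i) x (e i))) :=
        integral_mono (iw.const_mul _) (ig.add (iG.const_mul c)) hpt
    _ = _ := by
        rw [integral_add ig (iG.const_mul c), integral_const_mul, hG]; ring

theorem stmt_18 {n : ℕ} (hn : 3 ≤ n) (φ : EuclideanSpace ℝ (Fin n) → ℝ)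
    (hφ : ContDiff ℝ (⊤ : ℕ∞) φ) (hφc : HasCompactSupport φ) :
    (∫ x, ‖gradient φ x‖ ^ 2) ≥
      (((n : ℝ) - 2) ^ 2 / 4) * ∫ x, (φ x) ^ 2 / ‖x‖ ^ 2 := by
  have hφ1 : ContDiff ℝ 1 φ := hφ.of_le (by exact_mod_cast le_top)
  by_cases hI : Integrable (fun x => (φ x) ^ 2 / ‖x‖ ^ 2)
  swap
  · rw [integral_undef hI, mul_zero]
    exact integral_nonneg fun x => by positivity
  have : Nonempty (Fin n) := ⟨⟨0, by omega⟩⟩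
  have hne : ∀ᵐ x : EuclideanSpace ℝ (Fin n), x ≠ 0 := by
    simp [ae_iff]
  have hlim : Filter.Tendsto (fun k : ℕ => ∫ x, (φ x) ^ 2 * (‖x‖ ^ 2 + 1 / ((k : ℝ) + 1))⁻¹)
      Filter.atTop (nhds (∫ x, (φ x) ^ 2 / ‖x‖ ^ 2)) := by
    refine tendsto_integral_of_dominated_convergence _ (fun k => ?_) hI (fun k => ?_) ?_
    · refine Continuous.aestronglyMeasurable ?_
      refine (hφ1.continuous.pow 2).mul (Continuous.inv₀ (by fun_prop) ?_)
      intro x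
      positivity
    · filter_upwards [hne] with x hx
      have : 0 < ‖x‖ := norm_pos_iff.mpr hx
      rw [Real.norm_of_nonneg (by positivity), div_eq_mul_inv]
      have : 0 < 1 * ((k : ℝ) + 1)⁻¹ := by positivity
      refine mul_le_mul_of_nonneg_left (inv_anti₀ (by positivity) (by linarith)) (by positivity)
    · filter_upwards [hne] with x hx
      have : 0 < ‖x‖ := norm_pos_iff.mpr hx
      rw [div_eq_mul_inv]
      refine Filter.Tendsto.const_mul _ (Filter.Tendsto.inv₀ ?_ (by positivity))
      simpa using tendsto_one_div_add_atTop_nhds_zero_nat.const_add (‖x‖ ^ 2)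
  exact le_of_tendsto (hlim.const_mul _) (Filter.Eventually.of_forall fun k =>
    hardy_eps hn φ hφ1 hφc _ (by positivity))
end
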